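/- Let k ≥ 1, s ≥ 2 and n ≥ ks. Then m(n,k,s) ≥ m(n−1,k,s−1) + C(n−1,k−1), where m(n,k,s) denotes the maximum of |𝓕| over all families 𝓕 of k-element subsets of [n] with ν(𝓕) = s. (Indeed, if 𝓕₁ is a family of k-subsets of [2,n] with ν(𝓕₁) = s−1 of maximum size and 𝓕₂ is the family of all k-subsets of [n] containing 1, then 𝓕₁ ∪ 𝓕₂ has matching number exactly s.) -/

import Mathlib

/-- The matching number of a family of finite sets: the maximum number of
pairwise disjoint nonempty members. -/
noncomputable def matchNum (𝓕 : Finset (Finset ℕ)) : ℕ :=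
  sSup {m | ∃ M ⊆ 𝓕, M.card = m ∧ (∀ A ∈ M, A.Nonempty) ∧
    (M : Set (Finset ℕ)).Pairwise fun A B => Disjoint A B}

/-- A family of subsets of `[n] = {1,…,n}` is stable if it is closed downwards
under the "shifting" partial order: whenever `F ∈ 𝓕` and `G ⊆ [n]` admits a
bijection `φ : F → G` with `φ x ≤ x` for all `x ∈ F`, then `G ∈ 𝓕`. -/
def Stable (n : ℕ) (𝓕 : Finset (Finset ℕ)) : Prop :=
  ∀ F ∈ 𝓕, ∀ G : Finset ℕ, G ⊆ Finset.Icc 1 n → G.card = F.card →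
    (∃ φ : ℕ → ℕ, Set.BijOn φ (F : Set ℕ) (G : Set ℕ) ∧ ∀ x ∈ F, φ x ≤ x) → G ∈ 𝓕

/-- A family of `k`-element subsets of `[n]` is saturated if adding any new
`k`-element subset of `[n]` increases the matching number. -/
def Saturated (n k : ℕ) (𝓕 : Finset (Finset ℕ)) : Prop :=
  ∀ E : Finset ℕ, E ⊆ Finset.Icc 1 n → E.card = k → E ∉ 𝓕 →
    matchNum 𝓕 < matchNum (insert E 𝓕)

/-- `m(n,k,s)`: the maximum size of a family of `k`-element subsets of `[n]`
with matching number `s`. -/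
noncomputable def maxFamilySize (n k s : ℕ) : ℕ :=
  sSup {m | ∃ 𝓕 : Finset (Finset ℕ),
    𝓕 ⊆ Finset.powersetCard k (Finset.Icc 1 n) ∧ matchNum 𝓕 = s ∧ 𝓕.card = m}

open Finset

theorem bddAbove_matching_card (𝓕 : Finset (Finset ℕ)) :
    BddAbove {m | ∃ M ⊆ 𝓕, M.card = m ∧ (∀ A ∈ M, A.Nonempty) ∧
      (M : Set (Finset ℕ)).Pairwise fun A B => Disjoint A B} := by
  refine ⟨𝓕.card, ?_⟩
  rintro m ⟨M, hM, rfl, -⟩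
  exact card_le_card hM

theorem card_le_matchNum {𝓕 M : Finset (Finset ℕ)} (hM : M ⊆ 𝓕) (hne : ∀ A ∈ M, A.Nonempty)
    (hd : (M : Set (Finset ℕ)).Pairwise fun A B => Disjoint A B) : M.card ≤ matchNum 𝓕 :=
  le_csSup (bddAbove_matching_card 𝓕) ⟨M, hM, rfl, hne, hd⟩

theorem exists_matching_card_eq_matchNum (𝓕 : Finset (Finset ℕ)) :
    ∃ M ⊆ 𝓕, M.card = matchNum 𝓕 ∧ (∀ A ∈ M, A.Nonempty) ∧
      (M : Set (Finset ℕ)).Pairwise fun A B => Disjoint A B := by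
  have := Nat.sSup_mem (by exact ⟨0, ∅, by simp⟩) (bddAbove_matching_card 𝓕)
  exact this

/-- A family on `[n]` together with all sets `A ∪ {n + 1}`, where `A` is a `k`-subset of `[n]`. -/
def addStar (n k : ℕ) (𝓕 : Finset (Finset ℕ)) : Finset (Finset ℕ) :=
  𝓕 ∪ (powersetCard k (Icc 1 n)).image (insert (n + 1))

theorem notMem_of_mem_powersetCard_Icc {n k : ℕ} {A : Finset ℕ}
    (hA : A ∈ powersetCard k (Icc 1 n)) : n + 1 ∉ A := fun h => by
  have := mem_Icc.1 ((mem_powersetCard.1 hA).1 h)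
  omega

theorem addStar_subset {n k : ℕ} {𝓕 : Finset (Finset ℕ)}
    (h : 𝓕 ⊆ powersetCard (k + 1) (Icc 1 n)) :
    addStar n k 𝓕 ⊆ powersetCard (k + 1) (Icc 1 (n + 1)) := by
  have hsub : Icc 1 n ⊆ Icc 1 (n + 1) := Icc_subset_Icc_right (Nat.le_succ n)
  refine union_subset (h.trans (powersetCard_mono hsub)) (image_subset_iff.2 fun A hA => ?_)
  have hcard := card_insert_of_notMem (notMem_of_mem_powersetCard_Icc hA)
  rw [mem_powersetCard] at hA ⊢
  exact ⟨insert_subset (by simp) (hA.1.trans hsub), by rw [hcard, hA.2]⟩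

theorem card_addStar {n k : ℕ} {𝓕 : Finset (Finset ℕ)}
    (h : 𝓕 ⊆ powersetCard (k + 1) (Icc 1 n)) :
    (addStar n k 𝓕).card = 𝓕.card + n.choose k := by
  rw [addStar, card_union_of_disjoint, card_image_of_injOn, card_powersetCard, Nat.card_Icc,
    Nat.add_sub_cancel]
  · intro A hA B hB hAB
    rw [← erase_insert (notMem_of_mem_powersetCard_Icc (mem_coe.1 hA)),
      ← erase_insert (notMem_of_mem_powersetCard_Icc (mem_coe.1 hB))]
    exact congrArg (fun C => C.erase (n + 1)) hAB
  · refine disjoint_left.2 fun A hA hA' => ?_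
    obtain ⟨B, -, rfl⟩ := mem_image.1 hA'
    exact notMem_of_mem_powersetCard_Icc (h hA) (mem_insert_self _ _)

theorem matchNum_addStar_le (n k : ℕ) (𝓕 : Finset (Finset ℕ)) :
    matchNum (addStar n k 𝓕) ≤ matchNum 𝓕 + 1 := by
  obtain ⟨M, hM, hcard, hne, hd⟩ := exists_matching_card_eq_matchNum (addStar n k 𝓕)
  have hstar : (M.filter (n + 1 ∈ ·)).card ≤ 1 := by
    refine card_le_one.2 fun A hA B hB => ?_
    rw [mem_filter] at hA hB
    by_contra hAB
    exact disjoint_left.1 (hd hA.1 hB.1 hAB) hA.2 hB.2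
  have hrest : (M.filter (n + 1 ∉ ·)).card ≤ matchNum 𝓕 := by
    refine card_le_matchNum (fun A hA => ?_) (fun A hA => hne A (mem_filter.1 hA).1)
      (hd.mono (coe_subset.2 (filter_subset _ _)))
    rw [mem_filter] at hA
    rcases mem_union.1 (hM hA.1) with h | h
    · exact h
    · obtain ⟨B, -, rfl⟩ := mem_image.1 h
      exact absurd (mem_insert_self _ _) hA.2
  have := card_filter_add_card_filter_not (s := M) (n + 1 ∈ ·)
  omega

theorem le_matchNum_addStar {n k : ℕ} {𝓕 : Finset (Finset ℕ)}
    (h : 𝓕 ⊆ powersetCard (k + 1) (Icc 1 n)) (hn : (k + 1) * matchNum 𝓕 + k ≤ n) :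
    matchNum 𝓕 + 1 ≤ matchNum (addStar n k 𝓕) := by
  obtain ⟨M, hM, hcard, hne, hd⟩ := exists_matching_card_eq_matchNum 𝓕
  have hU : (M.biUnion id).card ≤ M.card * (k + 1) :=
    card_biUnion_le_card_mul _ _ _ fun A hA => (mem_powersetCard.1 (h (hM hA))).2.le
  have hk : k ≤ (Icc 1 n \ M.biUnion id).card := by
    have := le_card_sdiff (M.biUnion id) (Icc 1 n)
    rw [Nat.card_Icc] at this
    rw [hcard, mul_comm] at hU
    omega
  obtain ⟨B, hB, hBk⟩ := exists_subset_card_eq hk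
  have hBM : ∀ A ∈ M, Disjoint (insert (n + 1) B) A := fun A hA => by
    refine disjoint_insert_left.2 ⟨notMem_of_mem_powersetCard_Icc (h (hM hA)), ?_⟩
    exact (disjoint_of_subset_left hB sdiff_disjoint).mono_right (subset_biUnion_of_mem id hA)
  have hnot : insert (n + 1) B ∉ M := fun hmem =>
    notMem_of_mem_powersetCard_Icc (h (hM hmem)) (mem_insert_self _ _)
  rw [← hcard, ← card_insert_of_notMem hnot]
  refine card_le_matchNum (insert_subset ?_ (hM.trans subset_union_left)) ?_ ?_
  · exact mem_union_right _
      (mem_image_of_mem _ (mem_powersetCard.2 ⟨hB.trans sdiff_subset, hBk⟩))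
  · exact forall_mem_insert _ _ _ |>.2 ⟨insert_nonempty _ _, hne⟩
  · rw [coe_insert]
    exact hd.insert fun A hA _ => ⟨hBM A hA, (hBM A hA).symm⟩

theorem matchNum_addStar {n k : ℕ} {𝓕 : Finset (Finset ℕ)}
    (h : 𝓕 ⊆ powersetCard (k + 1) (Icc 1 n)) (hn : (k + 1) * matchNum 𝓕 + k ≤ n) :
    matchNum (addStar n k 𝓕) = matchNum 𝓕 + 1 :=
  (matchNum_addStar_le n k 𝓕).antisymm (le_matchNum_addStar h hn)

theorem exists_matchNum_eq (k t : ℕ) : ∀ n, (k + 1) * t ≤ n →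
    ∃ 𝓕 : Finset (Finset ℕ), 𝓕 ⊆ powersetCard (k + 1) (Icc 1 n) ∧ matchNum 𝓕 = t := by
  induction t with
  | zero =>
    intro n _
    obtain ⟨M, hM, hcard, -⟩ := exists_matching_card_eq_matchNum ∅
    exact ⟨∅, empty_subset _, by rw [← hcard, subset_empty.1 hM, card_empty]⟩
  | succ t ih =>
    intro n hn
    rw [Nat.mul_add_one] at hn
    obtain ⟨m, rfl⟩ : ∃ m, n = m + 1 := Nat.exists_eq_succ_of_ne_zero (by omega)
    obtain ⟨𝓕, h, rfl⟩ := ih m (by omega)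
    exact ⟨addStar m k 𝓕, addStar_subset h, matchNum_addStar h (by omega)⟩

theorem bddAbove_family_card (n k s : ℕ) :
    BddAbove {m | ∃ 𝓕 : Finset (Finset ℕ),
      𝓕 ⊆ powersetCard k (Icc 1 n) ∧ matchNum 𝓕 = s ∧ 𝓕.card = m} := by
  refine ⟨(powersetCard k (Icc 1 n)).card, ?_⟩
  rintro m ⟨𝓕, h, -, rfl⟩
  exact card_le_card h

theorem exists_card_eq_maxFamilySize {n k t : ℕ} (hn : (k + 1) * t ≤ n) :
    ∃ 𝓕 : Finset (Finset ℕ), 𝓕 ⊆ powersetCard (k + 1) (Icc 1 n) ∧ matchNum 𝓕 = t ∧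
      𝓕.card = maxFamilySize n (k + 1) t := by
  obtain ⟨𝓕, h, ht⟩ := exists_matchNum_eq k t n hn
  have := Nat.sSup_mem (by exact ⟨𝓕.card, 𝓕, h, ht, rfl⟩) (bddAbove_family_card n (k + 1) t)
  exact this

/-- `m(n,k,s) ≥ m(n−1,k,s−1) + C(n−1,k−1)` for `k ≥ 1`, `s ≥ 2`, `n ≥ ks`. -/
theorem maxFamilySize_lower_recursion (n k s : ℕ) (hk : 1 ≤ k) (hs : 2 ≤ s)
    (hn : k * s ≤ n) :
    maxFamilySize (n - 1) k (s - 1) + (n - 1).choose (k - 1) ≤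
      maxFamilySize n k s := by
  obtain ⟨k, rfl⟩ := Nat.exists_eq_add_of_le' hk
  obtain ⟨s, rfl⟩ := Nat.exists_eq_add_of_le' (one_le_two.trans hs)
  rw [Nat.mul_add_one] at hn
  obtain ⟨n, rfl⟩ : ∃ m, n = m + 1 := Nat.exists_eq_succ_of_ne_zero (by omega)
  simp only [Nat.add_sub_cancel]
  obtain ⟨𝓕, h, rfl, hcard⟩ := exists_card_eq_maxFamilySize (n := n) (k := k) (t := s) (by omega)
  rw [← hcard, ← card_addStar h]
  exact le_csSup (bddAbove_family_card _ _ _)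
    ⟨addStar n k 𝓕, addStar_subset h, matchNum_addStar h (by omega), rfl⟩
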